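/- For every real c with 0 < c < 1/6, Container of strength q = 1 has a winning strategy in the containment game on Z_eighth with spreading function g(t) = ⌈c·√t⌉, for every finite initial occupied set. Moreover, Container can win while deleting only the vertices of a single horizontal row [0, H] × {H}, whose height H depends only on the initial occupied set. -/

import Mathlib

open Set

/-- The number of vertices Container of strength `q` may delete at turn `t`:
`⌊t·q⌋ − ⌊(t−1)·q⌋`. -/
noncomputable def budget (q : ℝ) (t : ℕ) : ℕ :=
  (⌊(t : ℝ) * q⌋ - ⌊((t : ℝ) - 1) * q⌋).toNat

/-- The cumulative deleted sets determined by a Container strategy `σ`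
(mapping the history `[B 0, …, B t]` of occupied sets to the set of vertices deleted
at turn `t + 1`) against the occupied sets `B`. -/
def delSets {V : Type*} (σ : List (Set V) → Set V) (B : ℕ → Set V) : ℕ → Set V
  | 0 => ∅
  | t + 1 => delSets σ B t ∪ σ ((List.range (t + 1)).map B)

/-- Spreader's moves are legal with spread function `g` against cumulative deleted
sets `F`: occupied sets increase, at most `g (t + 1)` vertices are newly occupied at
turn `t + 1`, and each newly occupied vertex is undeleted and adjacent (with respect
to `adj`) to a previously occupied vertex. -/
def SpreaderLegal {V : Type*} (adj : V → V → Prop) (g : ℕ → ℕ∞)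
    (F B : ℕ → Set V) : Prop :=
  ∀ t : ℕ,
    B t ⊆ B (t + 1) ∧
    (B (t + 1) \ B t).encard ≤ g (t + 1) ∧
    ∀ v ∈ B (t + 1) \ B t, v ∉ F (t + 1) ∧ ∃ u ∈ B t, adj u v

/-- The Container strategy `σ` plays legally along occupied sets `B`: at every turn it
deletes only unoccupied vertices, and at most the budget of them. -/
def ContainerLegal {V : Type*} (q : ℝ) (σ : List (Set V) → Set V)
    (B : ℕ → Set V) : Prop :=
  ∀ t : ℕ,
    σ ((List.range (t + 1)).map B) ∩ B t = ∅ ∧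
    (σ ((List.range (t + 1)).map B)).encard ≤ (budget q (t + 1) : ℕ∞)

/-- Container of strength `q` wins the containment game on the graph `adj` with spread
function `g` and initial occupied set `B₀`, deleting only vertices of `A`: it has a
strategy which, against every legal Spreader play, is itself legal, deletes only
vertices of `A`, and forces the occupied set to eventually stabilize. -/
def ContainerWinsIn {V : Type*} (adj : V → V → Prop) (q : ℝ) (g : ℕ → ℕ∞)
    (B₀ : Set V) (A : Set V) : Prop :=
  ∃ σ : List (Set V) → Set V,
    ∀ B : ℕ → Set V, B 0 = B₀ → SpreaderLegal adj g (delSets σ B) B →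
      ContainerLegal q σ B ∧
      (∀ t : ℕ, σ ((List.range (t + 1)).map B) ⊆ A) ∧
      ∃ T : ℕ, ∀ t : ℕ, T ≤ t → B t = B T

/-- Container of strength `q` wins the containment game `(adj, q, g)` with initial
occupied set `B₀`. -/
def ContainerWins {V : Type*} (adj : V → V → Prop) (q : ℝ) (g : ℕ → ℕ∞)
    (B₀ : Set V) : Prop :=
  ContainerWinsIn adj q g B₀ Set.univ

/-- `q(G, g)`: the set of strengths `q > 0` for which Container wins the containment
game `(adj, q, g)` from every finite initial occupied set. -/
def qSet {V : Type*} (adj : V → V → Prop) (g : ℕ → ℕ∞) : Set ℝ :=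
  {q | 0 < q ∧ ∀ B₀ : Set V, B₀.Finite → ContainerWins adj q g B₀}

/-- The occupied sets determined by a Spreader strategy `τ` (mapping the history
`[F 1, …, F (t + 1)]` of cumulative deleted sets to the set of vertices newly occupied
at turn `t + 1`) against deleted sets `F`, starting from `B₀`. -/
def occSets {V : Type*} (τ : List (Set V) → Set V) (B₀ : Set V)
    (F : ℕ → Set V) : ℕ → Set V
  | 0 => B₀
  | t + 1 => occSets τ B₀ F t ∪ τ ((List.range (t + 1)).map fun i => F (i + 1))

/-- The sequence `F` of cumulative deleted sets is a legal play of Container of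
strength `q` against occupied sets `B`. -/
def ContainerSeqLegal {V : Type*} (q : ℝ) (F B : ℕ → Set V) : Prop :=
  F 0 = ∅ ∧ ∀ t : ℕ,
    F t ⊆ F (t + 1) ∧
    (F (t + 1) \ F t).encard ≤ (budget q (t + 1) : ℕ∞) ∧
    (F (t + 1) \ F t) ∩ B t = ∅

/-- Spreader wins the containment game `(adj, q, g)` with initial occupied set `B₀`:
it has a strategy which, against every legal Container play, is itself legal and
occupies new vertices at arbitrarily late times. -/
def SpreaderWins {V : Type*} (adj : V → V → Prop) (q : ℝ) (g : ℕ → ℕ∞)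
    (B₀ : Set V) : Prop :=
  ∃ τ : List (Set V) → Set V,
    ∀ F : ℕ → Set V, ContainerSeqLegal q F (occSets τ B₀ F) →
      SpreaderLegal adj g F (occSets τ B₀ F) ∧
      ∀ T : ℕ, ∃ t : ℕ, T ≤ t ∧ occSets τ B₀ F t ≠ occSets τ B₀ F T

/-- The strongly connected grid `ℤ ⊠ ℤ`. -/
def adjStrong (p q : ℤ × ℤ) : Prop :=
  max |p.1 - q.1| |p.2 - q.2| = 1

/-- The vertices of the eighth plane: `{(x, y) ∈ ℤ² : 0 ≤ x ≤ y}`. -/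
abbrev ZEighth : Type := {p : ℤ × ℤ // 0 ≤ p.1 ∧ p.1 ≤ p.2}

/-- The edges of the eighth plane: `(x, y) ~ (x + i, y + 1)` for `i ∈ {0, 1}`. -/
def adjEighth (p q : ZEighth) : Prop :=
  (q.val.2 = p.val.2 + 1 ∧ (q.val.1 = p.val.1 ∨ q.val.1 = p.val.1 + 1)) ∨
  (p.val.2 = q.val.2 + 1 ∧ (p.val.1 = q.val.1 ∨ p.val.1 = q.val.1 + 1))

/-- Chebyshev distance to the point `(z, H)`. -/
def cdist (H : ℕ) (z : ℕ) (v : ZEighth) : ℤ := max |v.val.1 - z| |v.val.2 - H|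

lemma cdist_adj (H z : ℕ) (u v : ZEighth) (h : adjEighth u v) :
    cdist H z u ≤ cdist H z v + 1 := by
  unfold adjEighth at h
  unfold cdist
  generalize u.val.1 = a at *
  generalize u.val.2 = b at *
  generalize v.val.1 = a' at *
  generalize v.val.2 = b' at *
  grind [abs]

/-- The evenly spaced set. -/
def spaced (p : ℕ) : Finset ℕ := (Finset.range (3 * p)).image (fun i => 12 * p * i)

lemma card_spaced (p : ℕ) (hp : 0 < p) : (spaced p).card = 3 * p := by
  unfold spaced
  rw [Finset.card_image_of_injective _ (fun a b h => by
    have : 0 < 12 * p := by omega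
    exact Nat.eq_of_mul_eq_mul_left this h)]
  simp

lemma spaced_sub (p : ℕ) : spaced p ⊆ Finset.range (36 * p ^ 2 + 1) := by
  intro z hz
  simp only [spaced, Finset.mem_image, Finset.mem_range] at hz ⊢
  obtain ⟨i, hi, rfl⟩ := hz
  nlinarith

lemma spaced_sep (p : ℕ) (z w : ℕ) (hz : z ∈ spaced p) (hw : w ∈ spaced p) (h : z ≠ w) :
    (12 * p : ℤ) ≤ |(z : ℤ) - w| := by
  simp only [spaced, Finset.mem_image, Finset.mem_range] at hz hw
  obtain ⟨i, hi, rfl⟩ := hz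
  obtain ⟨j, hj, rfl⟩ := hw
  have hij : (i : ℤ) - j ≠ 0 := by
    intro h'
    apply h
    have : i = j := by omega
    rw [this]
  have h1 : (1 : ℤ) ≤ |(i : ℤ) - j| := Int.one_le_abs hij
  have : (((12 * p * i : ℕ) : ℤ) - ((12 * p * j : ℕ) : ℤ)) = (12 * p : ℤ) * ((i : ℤ) - j) := by
    push_cast; ring
  rw [this, abs_mul, abs_of_nonneg (by positivity : (0 : ℤ) ≤ 12 * p)]
  nlinarith [Int.natCast_nonneg p]

/-- The first part of the deletion order. -/
noncomputable def ordP (p : ℕ) : List ℕ :=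
  (Finset.range (36 * p ^ 2 + 1) \ spaced p).toList

lemma length_ordP (p : ℕ) (hp : 0 < p) : (ordP p).length = 36 * p ^ 2 + 1 - 3 * p := by
  unfold ordP
  rw [Finset.length_toList, Finset.card_sdiff_of_subset (spaced_sub p), card_spaced p hp,
    Finset.card_range]

open Classical in
/-- The threatened positions. -/
noncomputable def thr (p : ℕ) (X : Set ZEighth) : Finset ℕ :=
  (spaced p).filter (fun z => ∃ v ∈ X, cdist (36 * p ^ 2) z v ≤ 3 * p)

/-- The deletion order. -/
noncomputable def ord (p : ℕ) (X : Set ZEighth) : List ℕ :=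
  ordP p ++ ((thr p X).toList ++ (spaced p \ thr p X).toList)

lemma mem_ord (p : ℕ) (X : Set ZEighth) (z : ℕ) (hz : z ≤ 36 * p ^ 2) : z ∈ ord p X := by
  simp only [ord, ordP, List.mem_append, Finset.mem_toList, Finset.mem_sdiff, Finset.mem_range]
  have : z < 36 * p ^ 2 + 1 := by omega
  tauto

lemma thr_sub (p : ℕ) (X : Set ZEighth) : thr p X ⊆ spaced p := by
  classical
  exact Finset.filter_subset _ _

lemma length_ord (p : ℕ) (hp : 0 < p) (X : Set ZEighth) :
    (ord p X).length = 36 * p ^ 2 + 1 := by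
  have h := Finset.card_sdiff_of_subset (thr_sub p X)
  have h' := Finset.card_le_card (thr_sub p X)
  have h2 : 3 * p ≤ 36 * p ^ 2 := by nlinarith
  simp only [ord, List.length_append, Finset.length_toList, length_ordP p hp, h,
    card_spaced p hp] at *
  omega

/-- The strategy. -/
noncomputable def strat (p : ℕ) (l : List (Set ZEighth)) : Set ZEighth :=
  {v | v.val.2 = ((36 * p ^ 2 : ℕ) : ℤ) ∧ ∃ z : ℕ, v.val.1 = z ∧
    (ord p (l.getD (ordP p).length ∅))[l.length - 1]? = some z}

lemma strat_spec (p : ℕ) (B : ℕ → Set ZEighth) (t : ℕ) (v : ZEighth) :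
    v ∈ strat p ((List.range (t + 1)).map B) ↔ v.val.2 = ((36 * p ^ 2 : ℕ) : ℤ) ∧
      ∃ z : ℕ, v.val.1 = z ∧ (ord p (B (ordP p).length))[t]? = some z := by
  unfold strat
  simp only [Set.mem_ofPred_eq, List.length_map, List.length_range, Nat.add_sub_cancel]
  have : (ord p (((List.range (t + 1)).map B).getD (ordP p).length ∅))[t]? =
      (ord p (B (ordP p).length))[t]? := by
    by_cases h : t < (ordP p).length
    · unfold ord
      rw [List.getElem?_append_left h, List.getElem?_append_left h]
    · have : ((List.range (t + 1)).map B).getD (ordP p).length ∅ = B (ordP p).length := by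
        have h2 : (ordP p).length < t + 1 := by omega
        simp [List.getD, h2]
      rw [this]
  rw [this]

lemma encard_diff_le {V : Type*} (B : ℕ → Set V) (p t k : ℕ)
    (h : ∀ i, t ≤ i → i < t + k → (B (i + 1) \ B i).encard ≤ (p : ℕ∞)) :
    (B (t + k) \ B t).encard ≤ ((k * p : ℕ) : ℕ∞) := by
  induction k with
  | zero => simp
  | succ k ih =>
    have h1 := ih (fun i hi hi' => h i hi (by omega))
    have h2 := h (t + k) (by omega) (by omega)
    have h3 : B (t + (k + 1)) \ B t ⊆ (B (t + k) \ B t) ∪ (B (t + k + 1) \ B (t + k)) := by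
      intro v hv
      by_cases hk : v ∈ B (t + k)
      · exact Or.inl ⟨hk, hv.2⟩
      · exact Or.inr ⟨hv.1, hk⟩
    calc _ ≤ _ := Set.encard_le_encard h3
      _ ≤ _ := Set.encard_union_le _ _
      _ ≤ _ := add_le_add h1 h2
      _ = _ := by push_cast; ring

lemma height_bound (B : ℕ → Set ZEighth) (p : ℕ)
    (hadj : ∀ t, ∀ v ∈ B (t + 1) \ B t, ∃ u ∈ B t, adjEighth u v)
    (h0 : ∀ v ∈ B 0, v.val.2 < p) (t : ℕ) : ∀ v ∈ B t, v.val.2 < p + t := by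
  induction t with
  | zero => simpa using h0
  | succ t ih =>
    intro v hv
    by_cases hk : v ∈ B t
    · have := ih v hk
      push_cast; omega
    · obtain ⟨u, hu, ha⟩ := hadj t v ⟨hv, hk⟩
      have := ih u hu
      unfold adjEighth at ha
      push_cast; omega

lemma ivt (B : ℕ → Set ZEighth) (H z : ℕ) (m : ℤ) (t' : ℕ)
    (hmono : ∀ t, B t ⊆ B (t + 1))
    (hadj : ∀ t, ∀ v ∈ B (t + 1) \ B t, ∃ u ∈ B t, adjEighth u v)
    (h0 : ∀ v ∈ B t', m ≤ cdist H z v) (j : ℕ) :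
    ∀ v ∈ B (t' + j), ∀ k, cdist H z v ≤ k → k < m → ∃ w ∈ B (t' + j), cdist H z w = k := by
  induction j with
  | zero =>
    intro v hv k h1 h2
    have := h0 v hv
    omega
  | succ j ih =>
    intro v hv k h1 h2
    by_cases hk : v ∈ B (t' + j)
    · obtain ⟨w, hw, e⟩ := ih v hk k h1 h2
      exact ⟨w, hmono _ hw, e⟩
    · by_cases he : cdist H z v = k
      · exact ⟨v, hv, he⟩
      · obtain ⟨u, hu, ha⟩ := hadj _ v ⟨hv, hk⟩
        have := cdist_adj H z u v ha
        obtain ⟨w, hw, e⟩ := ih u hu k (by omega) h2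
        exact ⟨w, hmono _ hw, e⟩

lemma lower (B : ℕ → Set ZEighth) (H z : ℕ) (m : ℤ) (t' : ℕ)
    (hadj : ∀ t, ∀ v ∈ B (t + 1) \ B t, ∃ u ∈ B t, adjEighth u v)
    (h0 : ∀ v ∈ B t', m ≤ cdist H z v) (j : ℕ) :
    ∀ v ∈ B (t' + j), m - j ≤ cdist H z v := by
  induction j with
  | zero => simpa using h0
  | succ j ih =>
    intro v hv
    by_cases hk : v ∈ B (t' + j)
    · have := ih v hk
      push_cast; omega
    · obtain ⟨u, hu, ha⟩ := hadj _ v ⟨hv, hk⟩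
      have := cdist_adj H z u v ha
      have := ih u hu
      push_cast; omega

lemma thr_card (B : ℕ → Set ZEighth) (p : ℕ) (hp : 0 < p)
    (hmono : ∀ t, B t ⊆ B (t + 1))
    (hadj : ∀ t, ∀ v ∈ B (t + 1) \ B t, ∃ u ∈ B t, adjEighth u v)
    (hcard : ∀ t, t + 1 ≤ 36 * p ^ 2 → (B (t + 1) \ B t).encard ≤ (p : ℕ∞))
    (h0 : ∀ v ∈ B 0, v.val.2 < p) :
    (thr p (B (ordP p).length)).card ≤ 2 * p := by
  classical
  have hH : 36 * p ≤ 36 * p ^ 2 := by nlinarith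
  have hl := length_ordP p hp
  obtain ⟨t', ht'⟩ : ∃ t', (ordP p).length = t' + 2 * p :=
    ⟨36 * p ^ 2 + 1 - 3 * p - 2 * p, by omega⟩
  rw [ht'] at hl ⊢
  set H := 36 * p ^ 2 with hHdef
  have hfar : ∀ z, ∀ v ∈ B t', (4 * p : ℤ) ≤ cdist H z v := by
    intro z v hv
    have h1 := height_bound B p hadj h0 t' v hv
    have h2 : |v.val.2 - H| ≤ cdist H z v := le_max_right _ _
    have h3 := neg_le_abs (v.val.2 - (H : ℤ))
    omega
  have hex : ∀ q : ℕ × ℕ, ∃ w : ZEighth, q ∈ thr p (B (t' + 2 * p)) ×ˢ Finset.range p →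
      (w ∈ B (t' + 2 * p) \ B t' ∧ cdist H q.1 w = 3 * p + q.2) := by
    intro q
    by_cases hq : q ∈ thr p (B (t' + 2 * p)) ×ˢ Finset.range p
    · simp only [Finset.mem_product, Finset.mem_range, thr, Finset.mem_filter] at hq
      obtain ⟨⟨_, v, hv, hd⟩, hk⟩ := hq
      obtain ⟨w, hw, e⟩ := ivt B H q.1 (4 * p) t' hmono hadj (hfar q.1) (2 * p) v hv
        (3 * p + q.2) (by rw [← hHdef] at hd; omega) (by omega)
      refine ⟨w, fun _ => ⟨⟨hw, fun hw' => ?_⟩, e⟩⟩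
      have := hfar q.1 w hw'
      omega
    · obtain ⟨w⟩ : Nonempty ZEighth := ⟨⟨(0, 0), by simp⟩⟩
      exact ⟨w, fun h => absurd h hq⟩
  choose f hf using hex
  have hinj : Set.InjOn f (thr p (B (t' + 2 * p)) ×ˢ Finset.range p : Finset (ℕ × ℕ)) := by
    intro a ha b hb hab
    rw [Finset.mem_coe] at ha hb
    have h1 := (hf a ha).2
    have h2 := (hf b hb).2
    rw [hab] at h1
    simp only [Finset.mem_product, Finset.mem_range] at ha hb
    have hz : a.1 = b.1 := by
      by_contra hne
      have hs := spaced_sep p a.1 b.1 (thr_sub _ _ ha.1) (thr_sub _ _ hb.1) hne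
      have h3 : |(f b).val.1 - a.1| ≤ cdist H a.1 (f b) := le_max_left _ _
      have h4 : |(f b).val.1 - b.1| ≤ cdist H b.1 (f b) := le_max_left _ _
      have h5 : |(a.1 : ℤ) - b.1| ≤ |(f b).val.1 - a.1| + |(f b).val.1 - b.1| := by
        rw [abs_sub_comm _ (a.1 : ℤ)]
        exact abs_sub_le _ _ _
      omega
    rw [hz] at h1
    have : a.2 = b.2 := by omega
    exact Prod.ext hz this
  have hc := encard_diff_le B p t' (2 * p) (fun i _ hi => hcard i (by omega))
  have hsub : (((thr p (B (t' + 2 * p)) ×ˢ Finset.range p).image f : Finset ZEighth) :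
      Set ZEighth) ⊆ B (t' + 2 * p) \ B t' := by
    intro w hw
    simp only [Finset.coe_image, Set.mem_image, Finset.mem_coe] at hw
    obtain ⟨q, hq, rfl⟩ := hw
    exact (hf q hq).1
  have h6 := (Set.encard_le_encard hsub).trans hc
  rw [Set.encard_coe_eq_coe_finsetCard, Finset.card_image_of_injOn hinj, Finset.card_product,
    Finset.card_range] at h6
  have h7 : (thr p (B (t' + 2 * p))).card * p ≤ 2 * p * p := by exact_mod_cast h6
  exact Nat.le_of_mul_le_mul_right h7 hp

lemma strat_legal (B : ℕ → Set ZEighth) (p : ℕ) (hp : 0 < p)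
    (hmono : ∀ t, B t ⊆ B (t + 1))
    (hadj : ∀ t, ∀ v ∈ B (t + 1) \ B t, ∃ u ∈ B t, adjEighth u v)
    (hcard : ∀ t, t + 1 ≤ 36 * p ^ 2 → (B (t + 1) \ B t).encard ≤ (p : ℕ∞))
    (h0 : ∀ v ∈ B 0, v.val.2 < p) (i z : ℕ) (v : ZEighth)
    (hi : (ord p (B (ordP p).length))[i]? = some z)
    (hv1 : v.val.1 = z) (hv2 : v.val.2 = ((36 * p ^ 2 : ℕ) : ℤ)) : v ∉ B i := by
  classical
  intro hv
  have hT := thr_card B p hp hmono hadj hcard h0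
  have hb := height_bound B p hadj h0 i v hv
  have hH : 36 * p ≤ 36 * p ^ 2 := by nlinarith
  have hl := length_ordP p hp
  have hL := length_ord p hp (B (ordP p).length)
  have hiL : i < 36 * p ^ 2 + 1 := by
    rw [← hL]
    exact (List.getElem?_eq_some_iff.1 hi).1
  set X := B (ordP p).length with hX
  have hge : (ordP p).length + (thr p X).toList.length ≤ i := by
    rw [Finset.length_toList]
    omega
  unfold ord at hi
  rw [List.getElem?_append_right (by omega), List.getElem?_append_right (by omega)] at hi
  have hz := List.mem_of_getElem? hi
  simp only [Finset.mem_toList, Finset.mem_sdiff, thr, Finset.mem_filter, not_and, not_exists,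
    not_le] at hz
  have hz2 := hz.2 hz.1
  obtain ⟨j, rfl⟩ : ∃ j, i = (ordP p).length + j := ⟨i - (ordP p).length, by omega⟩
  have h8 := lower B (36 * p ^ 2) z (3 * p + 1) (ordP p).length hadj
    (fun u hu => by have := hz2 u hu; omega) j v hv
  have h9 : cdist (36 * p ^ 2) z v = 0 := by
    unfold cdist
    rw [hv1, hv2]
    simp
  omega

lemma mem_delSets {V : Type*} (σ : List (Set V) → Set V) (B : ℕ → Set V) (v : V) (j : ℕ)
    (h : v ∈ σ ((List.range (j + 1)).map B)) (t : ℕ) (ht : j < t) : v ∈ delSets σ B t := by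
  induction t with
  | zero => omega
  | succ t ih =>
    by_cases hj : j = t
    · subst hj
      exact Or.inr h
    · exact Or.inl (ih (by omega))

lemma stabilize {V : Type*} (B : ℕ → Set V) (hmono : Monotone B) (F : Set V) (hF : F.Finite)
    (h : ∀ t, B t ⊆ F) : ∃ T : ℕ, ∀ t : ℕ, T ≤ t → B t = B T := by
  classical
  have hex : ∀ v : V, ∃ s : ℕ, ∀ t, v ∈ B t → v ∈ B s := by
    intro v
    by_cases hv : ∃ s, v ∈ B s
    · obtain ⟨s, hs⟩ := hv
      exact ⟨s, fun _ _ => hs⟩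
    · exact ⟨0, fun t ht => absurd ⟨t, ht⟩ hv⟩
  choose s hs using hex
  refine ⟨hF.toFinset.sup s, fun t ht => Set.Subset.antisymm (fun v hv => ?_) (hmono ht)⟩
  exact hmono (Finset.le_sup (f := s) (hF.mem_toFinset.2 (h t hv))) (hs v t hv)

lemma budget_one (t : ℕ) : budget 1 (t + 1) = 1 := by
  unfold budget
  simp

lemma ceil_bound (c : ℝ) (hc0 : 0 < c) (hc : c < 1 / 6) (p t : ℕ) (ht : t ≤ 36 * p ^ 2) :
    ⌈c * Real.sqrt (t : ℝ)⌉₊ ≤ p := by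
  rw [Nat.ceil_le]
  have h1 : Real.sqrt (t : ℝ) ≤ 6 * p := by
    rw [Real.sqrt_le_left (by positivity)]
    have : (t : ℝ) ≤ ((36 * p ^ 2 : ℕ) : ℝ) := by exact_mod_cast ht
    push_cast at this
    nlinarith
  have h2 := Real.sqrt_nonneg (t : ℝ)
  nlinarith

/-- **Proposition.** For every `0 < c < 1/6`, Container of strength `q = 1` wins the
containment game on the eighth plane with spreading function `g(t) = ⌈c·√t⌉` from
any finite initial occupied set, deleting only the vertices of a single horizontal
row `[0, H] × {H}` whose height `H` depends only on the initial occupied set. -/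
theorem container_wins_sqrt_eighth_single_row (c : ℝ) (hc0 : 0 < c) (hc : c < 1 / 6)
    (B₀ : Set ZEighth) (hB₀ : B₀.Finite) :
    ∃ H : ℤ, ContainerWinsIn adjEighth 1
      (fun t => (⌈c * Real.sqrt (t : ℝ)⌉₊ : ℕ∞)) B₀
      {p : ZEighth | p.val.2 = H} := by
  obtain ⟨p, hp, hB⟩ : ∃ p : ℕ, 0 < p ∧ ∀ v ∈ B₀, v.val.2 < p := by
    obtain ⟨M, hM⟩ := (hB₀.image (fun v : ZEighth => v.val.2)).bddAbove
    refine ⟨M.toNat + 1, by omega, fun v hv => ?_⟩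
    have := hM (Set.mem_image_of_mem (fun v : ZEighth => v.val.2) hv)
    omega
  refine ⟨((36 * p ^ 2 : ℕ) : ℤ), strat p, fun B hB0 hleg => ?_⟩
  have h0 : ∀ v ∈ B 0, v.val.2 < p := by rw [hB0]; exact hB
  have hmono : ∀ t, B t ⊆ B (t + 1) := fun t => (hleg t).1
  have hadj : ∀ t, ∀ v ∈ B (t + 1) \ B t, ∃ u ∈ B t, adjEighth u v :=
    fun t v hv => ((hleg t).2.2 v hv).2
  have hcard : ∀ t, t + 1 ≤ 36 * p ^ 2 → (B (t + 1) \ B t).encard ≤ (p : ℕ∞) := by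
    intro t ht
    refine (hleg t).2.1.trans ?_
    exact Nat.cast_le.2 (ceil_bound c hc0 hc p (t + 1) ht)
  have hMono : Monotone B := monotone_nat_of_le_succ hmono
  have hlegal := strat_legal B p hp hmono hadj hcard h0
  refine ⟨fun t => ⟨?_, ?_⟩, fun t v hv => ((strat_spec p B t v).1 hv).1, ?_⟩
  · ext v
    simp only [Set.mem_inter_iff, Set.mem_empty_iff_false, iff_false, not_and]
    intro hv
    obtain ⟨h2, z, h1, hz⟩ := (strat_spec p B t v).1 hv
    exact hlegal t z v hz h1 h2
  · rw [budget_one, Nat.cast_one, Set.encard_le_one_iff]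
    intro a b ha hb
    obtain ⟨h2, z, h1, hz⟩ := (strat_spec p B t a).1 ha
    obtain ⟨h2', z', h1', hz'⟩ := (strat_spec p B t b).1 hb
    rw [hz] at hz'
    cases hz'
    exact Subtype.ext (Prod.ext (h1.trans h1'.symm) (h2.trans h2'.symm))
  · have hrow : ∀ t, ∀ v ∈ B t, v.val.2 < ((36 * p ^ 2 : ℕ) : ℤ) := by
      intro t
      induction t with
      | zero =>
        intro v hv
        have := h0 v hv
        have hH : p ≤ 36 * p ^ 2 := by nlinarith
        omega
      | succ t ih =>
        intro v hv
        by_cases hk : v ∈ B t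
        · exact ih v hk
        · obtain ⟨hF, u, hu, ha⟩ := (hleg t).2.2 v ⟨hv, hk⟩
          have hu' := ih u hu
          have hne : v.val.2 ≠ ((36 * p ^ 2 : ℕ) : ℤ) := by
            intro he
            obtain ⟨z, hz⟩ : ∃ z : ℕ, v.val.1 = z := ⟨v.val.1.toNat, by have := v.2.1; omega⟩
            have hm := mem_ord p (B (ordP p).length) z (by have := v.2.2; omega)
            obtain ⟨j, hj⟩ := List.mem_iff_getElem?.1 hm
            by_cases hjt : j < t + 1
            · exact hF (mem_delSets _ B v j ((strat_spec p B j v).2 ⟨he, z, hz, hj⟩) _ hjt)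
            · exact hlegal j z v hj hz he (hMono (by omega : t + 1 ≤ j) hv)
          unfold adjEighth at ha
          omega
    refine stabilize B hMono {v : ZEighth | v.val.2 < ((36 * p ^ 2 : ℕ) : ℤ)} ?_ hrow
    refine Set.Finite.subset (Set.Finite.preimage (f := Subtype.val) Subtype.val_injective.injOn
      ((Set.finite_Icc (0 : ℤ) ((36 * p ^ 2 : ℕ) : ℤ)).prod
        (Set.finite_Icc (0 : ℤ) ((36 * p ^ 2 : ℕ) : ℤ)))) ?_
    intro v hv
    have h1 := v.2.1
    have h2 := v.2.2
    simp only [Set.mem_ofPred_eq] at hv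
    simp only [Set.mem_preimage, Set.mem_prod, Set.mem_Icc]
    omega
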